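/- If an onto, strategyproof mechanism f on a discrete tree violates ADR, then there exists a violating pair of profiles a, a' = (a_{-i}, a'_i) (i.e., f(a) ≠ f(a'), tree(a_i → a'_i, f(a)) = tree(a_i → a'_i, f(a')), and the ADR conclusion fails) such that, letting z be the unique vertex in [a_i, f(a)] ∩ [a_i, f(a')] ∩ [f(a), f(a')], it holds that z = a'_i and d(f(a), z) = d(f(a'), z). -/

import Mathlib

open Function

/-- `T = (V,E)` is a discrete tree: connected, acyclic, bounded degree. -/
def IsDiscreteTree {V : Type*} (G : SimpleGraph V) : Prop :=
  G.Connected ∧ G.IsAcyclic ∧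
    ∃ D : ℕ, ∀ v : V, (G.neighborSet v).Finite ∧ (G.neighborSet v).ncard ≤ D

/-- `pathSet G u w` is the vertex set of the unique path `[u,w]`
(in a tree, exactly the vertices lying on a geodesic from `u` to `w`). -/
def pathSet {V : Type*} (G : SimpleGraph V) (u w : V) : Set V :=
  {v | G.dist u v + G.dist v w = G.dist u w}

/-- `subtree G a b v` = `tree(a → b, v)`: the set of vertices reachable from `v`
via edges that do not lie on the path `[a,b]`. -/
def subtree {V : Type*} (G : SimpleGraph V) (a b v : V) : Set V :=
  {u | Relation.ReflTransGen
        (fun x y => G.Adj x y ∧ ¬(x ∈ pathSet G a b ∧ y ∈ pathSet G a b)) v u}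

/-- Distance from a vertex to a set of vertices. -/
noncomputable def distToSet {V : Type*} (G : SimpleGraph V) (x : V) (S : Set V) : ℕ :=
  sInf (G.dist x '' S)

/-- Distance between two sets of vertices. -/
noncomputable def setDist {V : Type*} (G : SimpleGraph V) (A B : Set V) : ℕ :=
  sInf {d : ℕ | ∃ u ∈ A, ∃ w ∈ B, G.dist u w = d}

/-- `depth(a → b, v)`: the distance of `v` from the path `[a,b]`. -/
noncomputable def depth {V : Type*} (G : SimpleGraph V) (a b v : V) : ℕ :=
  distToSet G v (pathSet G a b)

/-- A mechanism is strategyproof if no agent can get the facility strictly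
closer to her true location by misreporting. -/
def Strategyproof {V : Type*} {n : ℕ} (G : SimpleGraph V)
    (f : (Fin n → V) → V) : Prop :=
  ∀ (a : Fin n → V) (i : Fin n) (b : V),
    G.dist (a i) (f a) ≤ G.dist (a i) (f (Function.update a i b))

/-- Almost depth restricted (ADR): whenever a single agent's deviation moves
the facility within the same tree (w.r.t. the move), the old and new outcomes
are both at distance exactly 1 from the meeting point `z` of the three paths. -/
def ADR {V : Type*} {n : ℕ} (G : SimpleGraph V) (f : (Fin n → V) → V) : Prop :=
  ∀ (a : Fin n → V) (i : Fin n) (b : V),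
    f a ≠ f (Function.update a i b) →
    subtree G (a i) b (f a) = subtree G (a i) b (f (Function.update a i b)) →
    ∀ z ∈ pathSet G (a i) (f a) ∩ pathSet G (a i) (f (Function.update a i b)) ∩
            pathSet G (f a) (f (Function.update a i b)),
      G.dist (f a) z = G.dist (f (Function.update a i b)) z ∧
      G.dist (f a) z = 1

namespace SimpleGraph

variable {V : Type*} {G : SimpleGraph V}

lemma mem_pathSet_iff {u v w : V} :
    v ∈ pathSet G u w ↔ G.dist u v + G.dist v w = G.dist u w := Iff.rfl

lemma Walk.mem_pathSet {u v w : V} (hG : G.Connected) (p : G.Walk u w)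
    (hp : p.length = G.dist u w) (hv : v ∈ p.support) : v ∈ pathSet G u w := by
  obtain ⟨q, r, rfl⟩ := Walk.mem_support_iff_exists_append.mp hv
  have h₁ := dist_le q
  have h₂ := dist_le r
  have h₃ := hG.dist_triangle (u := u) (v := v) (w := w)
  rw [Walk.length_append] at hp
  rw [mem_pathSet_iff]
  omega

/-- In an acyclic graph, every walk between `u` and `w` visits all of `[u, w]`. -/
lemma IsTree.mem_support_of_mem_pathSet (hG : G.IsTree) {u v w : V} (hv : v ∈ pathSet G u w)
    (p : G.Walk u w) : v ∈ p.support := by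
  classical
  obtain ⟨q, hq⟩ := hG.connected.exists_walk_length_eq_dist u v
  obtain ⟨r, hr⟩ := hG.connected.exists_walk_length_eq_dist v w
  have hqr : (q.append r).IsPath :=
    Walk.isPath_of_length_eq_dist _ (by rw [Walk.length_append, hq, hr]; exact hv)
  have h := (hG.isAcyclic.subsingleton_path u w).elim ⟨_, hqr⟩ p.toPath
  have hvs : v ∈ (p.toPath : G.Walk u w).support := by
    rw [← h]
    exact (Walk.mem_support_append_iff _ _).mpr (.inl q.end_mem_support)
  exact p.support_bypass_subset_support hvs

lemma IsTree.mem_pathSet_or (hG : G.IsTree) {u v w : V} (hv : v ∈ pathSet G u w) (x : V) :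
    v ∈ pathSet G u x ∨ v ∈ pathSet G x w := by
  obtain ⟨p, hp⟩ := hG.connected.exists_walk_length_eq_dist u x
  obtain ⟨q, hq⟩ := hG.connected.exists_walk_length_eq_dist x w
  refine ((Walk.mem_support_append_iff _ _).mp
    (hG.mem_support_of_mem_pathSet hv (p.append q))).imp ?_ ?_
  · exact Walk.mem_pathSet hG.connected p hp
  · exact Walk.mem_pathSet hG.connected q hq

lemma pathSet_comm (u w : V) : pathSet G u w = pathSet G w u := by
  ext v
  rw [mem_pathSet_iff, mem_pathSet_iff, G.dist_comm (u := u) (v := v),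
    G.dist_comm (u := v) (v := w), G.dist_comm (u := u) (v := w), add_comm]

/-- The three sides of a triangle in a tree meet in at most one vertex. -/
lemma IsTree.eq_of_mem_pathSet (hG : G.IsTree) {u v w y z : V}
    (hy : y ∈ pathSet G u v ∩ pathSet G u w ∩ pathSet G v w)
    (hz : z ∈ pathSet G u v ∩ pathSet G u w ∩ pathSet G v w) : y = z := by
  obtain ⟨⟨hy₁, hy₂⟩, hy₃⟩ := hy
  obtain ⟨⟨hz₁, hz₂⟩, hz₃⟩ := hz
  have h := hG.mem_pathSet_or hy₁ z
  rw [← hG.connected.dist_eq_zero_iff]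
  simp only [mem_pathSet_iff] at *
  have e₁ := G.dist_comm (u := v) (v := y)
  have e₂ := G.dist_comm (u := v) (v := z)
  have e₃ := G.dist_comm (u := z) (v := y)
  omega

/-- Deleting `z ∈ [a, b]` separates the vertices `y` with `z ∉ [b, y]` from the others, and the
only edge joining the two sides lies on `[a, b]`. -/
lemma IsTree.notMem_pathSet_of_mem_subtree (hG : G.IsTree) {a b u v z : V}
    (hz : z ∈ pathSet G a b) (hv : v ∈ subtree G a b u) (hu : z ∉ pathSet G b u) :
    z ∉ pathSet G b v := by
  induction hv with
  | refl => exact hu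
  | @tail x y _ hxy hx =>
    intro hy
    obtain ⟨hadj, hmem⟩ := hxy
    have hd := dist_eq_one_iff_adj.mpr hadj
    have hzxy : z ∈ pathSet G x y := (hG.mem_pathSet_or hy x).resolve_left hx
    have hyz : y = z := by
      rw [mem_pathSet_iff, hd] at hzxy
      have : G.dist x z ≠ 0 := by
        rw [Ne, hG.connected.dist_eq_zero_iff]
        rintro rfl
        exact hx (by simp [mem_pathSet_iff])
      rw [← hG.connected.dist_eq_zero_iff, dist_comm]
      omega
    subst hyz
    refine hmem ⟨?_, hz⟩
    have hax : y ∈ pathSet G a x :=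
      (hG.mem_pathSet_or hz x).resolve_right (by rwa [pathSet_comm])
    have hne := hG.dist_ne_of_adj b hadj
    have ht := hG.connected.dist_triangle (u := b) (v := y) (w := x)
    have ht' := hG.connected.dist_triangle (u := b) (v := x) (w := y)
    simp only [mem_pathSet_iff] at *
    have e₁ := G.dist_comm (u := x) (v := y)
    have e₂ := G.dist_comm (u := x) (v := b)
    have e₃ := G.dist_comm (u := y) (v := b)
    omega

lemma IsTree.mem_pathSet_of_subtree_eq (hG : G.IsTree) {a b u v z : V}
    (h : subtree G a b u = subtree G a b v) (hz : z ∈ pathSet G a u) (hz' : z ∈ pathSet G u v) :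
    z ∈ pathSet G b u := by
  rcases hG.mem_pathSet_or hz b with hab | hbu
  · by_contra hbu
    have hv : v ∈ subtree G a b u := h ▸ Relation.ReflTransGen.refl
    have hbv := hG.notMem_pathSet_of_mem_subtree hab hv hbu
    rcases hG.mem_pathSet_or hz' b with h₁ | h₁
    · exact hbu (pathSet_comm u b ▸ h₁)
    · exact hbv h₁
  · exact hbu

lemma Connected.mem_subtree_of_mem_pathSet (hG : G.Connected) {a z y : V}
    (hy : z ∈ pathSet G a y) : y ∈ subtree G a z z := by
  obtain ⟨n, hn⟩ : ∃ n, G.dist z y = n := ⟨_, rfl⟩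
  induction n generalizing y with
  | zero => exact (hG.dist_eq_zero_iff.mp hn) ▸ Relation.ReflTransGen.refl
  | succ n ih =>
    obtain ⟨p, hp⟩ := hG.exists_walk_length_eq_dist y z
    cases p with
    | nil => simp at hn
    | @cons _ x _ hadj q =>
      have hq := dist_le q
      rw [Walk.length_cons] at hp
      have hd := dist_eq_one_iff_adj.mpr hadj.symm
      have ht := hG.dist_triangle (u := z) (v := x) (w := y)
      have ht' := hG.dist_triangle (u := a) (v := x) (w := y)
      have ht₂ := hG.dist_triangle (u := a) (v := z) (w := x)
      have e₁ := G.dist_comm (u := x) (v := z)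
      have e₂ := G.dist_comm (u := y) (v := z)
      rw [mem_pathSet_iff] at hy
      refine (ih (by rw [mem_pathSet_iff]; omega) (by omega)).tail ⟨hadj.symm, fun h => ?_⟩
      have := mem_pathSet_iff.mp h.2
      omega

lemma subtree_eq_of_mem {a b u v : V} (h : v ∈ subtree G a b u) :
    subtree G a b u = subtree G a b v := by
  have hsymm : Std.Symm (fun x y => G.Adj x y ∧ ¬(x ∈ pathSet G a b ∧ y ∈ pathSet G a b)) :=
    ⟨fun x y hxy => ⟨hxy.1.symm, fun h => hxy.2 h.symm⟩⟩
  ext w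
  exact ⟨fun hw => (Relation.ReflTransGen.stdSymm.symm _ _ h).trans hw, fun hw => h.trans hw⟩

lemma Connected.subtree_eq_of_mem_pathSet (hG : G.Connected) {a z u v : V}
    (hu : z ∈ pathSet G a u) (hv : z ∈ pathSet G a v) : subtree G a z u = subtree G a z v :=
  (subtree_eq_of_mem (hG.mem_subtree_of_mem_pathSet hu)).symm.trans
    (subtree_eq_of_mem (hG.mem_subtree_of_mem_pathSet hv))

end SimpleGraph

open SimpleGraph in
/-- A deviation to the meeting point `z` of the three paths, with both outcomes at the same
distance `k ≥ 2` from `z`, violates ADR. -/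
lemma violates_of_deviates_to_meeting_point {V : Type*} {G : SimpleGraph V} (hG : G.IsTree)
    {x z p q : V} (hp : z ∈ pathSet G x p) (hq : z ∈ pathSet G x q) (hpq : z ∈ pathSet G p q)
    (hd : G.dist z p = G.dist z q) (hk : 2 ≤ G.dist z p) :
    p ≠ q ∧ subtree G x z p = subtree G x z q ∧
      ¬ (∀ y ∈ pathSet G x p ∩ pathSet G x q ∩ pathSet G p q,
          G.dist p y = G.dist q y ∧ G.dist p y = 1) ∧
      (∀ y ∈ pathSet G x p ∩ pathSet G x q ∩ pathSet G p q,
          y = z ∧ G.dist p y = G.dist q y) := by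
  have e₁ := G.dist_comm (u := z) (v := p)
  have e₂ := G.dist_comm (u := z) (v := q)
  refine ⟨?_, hG.connected.subtree_eq_of_mem_pathSet hp hq, fun h => ?_, fun y hy => ?_⟩
  · rintro rfl
    rw [mem_pathSet_iff, dist_self] at hpq
    omega
  · have := (h z ⟨⟨hp, hq⟩, hpq⟩).2
    omega
  · obtain rfl := hG.eq_of_mem_pathSet hy ⟨⟨hp, hq⟩, hpq⟩
    exact ⟨rfl, by omega⟩

/-- if an onto, strategyproof mechanism on a discrete tree
violates ADR, then there is a violating pair in which the deviating agent
moves exactly to the meeting point `z` of the three paths, and the old and new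
outcomes are equidistant from `z`. -/
theorem adr_violation_normal_form {V : Type*} {n : ℕ} (G : SimpleGraph V)
    (hT : IsDiscreteTree G) (f : (Fin n → V) → V)
    (hSP : Strategyproof G f) (hOnto : Function.Surjective f)
    (hviol : ¬ ADR G f) :
    ∃ (a : Fin n → V) (i : Fin n) (b : V),
      f a ≠ f (Function.update a i b) ∧
      subtree G (a i) b (f a) = subtree G (a i) b (f (Function.update a i b)) ∧
      ¬ (∀ z ∈ pathSet G (a i) (f a) ∩ pathSet G (a i) (f (Function.update a i b)) ∩
              pathSet G (f a) (f (Function.update a i b)),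
          G.dist (f a) z = G.dist (f (Function.update a i b)) z ∧
          G.dist (f a) z = 1) ∧
      (∀ z ∈ pathSet G (a i) (f a) ∩ pathSet G (a i) (f (Function.update a i b)) ∩
              pathSet G (f a) (f (Function.update a i b)),
          z = b ∧ G.dist (f a) z = G.dist (f (Function.update a i b)) z) := by
  have hG : G.IsTree := ⟨hT.1, hT.2.1⟩
  simp only [ADR, not_forall] at hviol
  obtain ⟨a, i, b, hne, htree, z, ⟨⟨hap, haq⟩, hpq⟩, hfail⟩ := hviol
  have hbp := hG.mem_pathSet_of_subtree_eq htree hap hpq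
  have hbq := hG.mem_pathSet_of_subtree_eq htree.symm haq (SimpleGraph.pathSet_comm _ _ ▸ hpq)
  have hSPaq := hSP a i b
  have hSPaw := hSP a i z
  have hSPbp := hSP (update a i b) i (a i)
  have hSPbw := hSP (update a i b) i z
  have hSPzp := hSP (update a i z) i (a i)
  simp only [update_idem, update_self, update_eq_self] at hSPbp hSPbw hSPzp
  set p := f a
  set q := f (update a i b)
  set w := f (update a i z)
  have e₁ := G.dist_comm (u := z) (v := p)
  have e₂ := G.dist_comm (u := z) (v := q)
  have haw := hT.1.dist_triangle (u := a i) (v := z) (w := w)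
  have hbw := hT.1.dist_triangle (u := b) (v := z) (w := w)
  have hpq0 : G.dist p q ≠ 0 := by rwa [Ne, hT.1.dist_eq_zero_iff]
  have hap' := SimpleGraph.mem_pathSet_iff.mp hap
  have haq' := SimpleGraph.mem_pathSet_iff.mp haq
  have hbp' := SimpleGraph.mem_pathSet_iff.mp hbp
  have hbq' := SimpleGraph.mem_pathSet_iff.mp hbq
  have hpq' := SimpleGraph.mem_pathSet_iff.mp hpq
  have hwp : z ∈ pathSet G (a i) w := by rw [SimpleGraph.mem_pathSet_iff]; omega
  have hwq : z ∈ pathSet G b w := by rw [SimpleGraph.mem_pathSet_iff]; omega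
  have hk : 2 ≤ G.dist z p := by omega
  have hzq : G.dist z q = G.dist z p := by omega
  have hzw : G.dist z w = G.dist z p := by omega
  rcases hG.mem_pathSet_or hpq w with h | h
  · exact ⟨a, i, z, violates_of_deviates_to_meeting_point hG hap hwp h hzw.symm hk⟩
  · refine ⟨update a i b, i, z, ?_⟩
    rw [update_idem, update_self]
    rw [SimpleGraph.pathSet_comm] at h
    exact violates_of_deviates_to_meeting_point hG hbq hwq h (hzq.trans hzw.symm) (hzq.symm ▸ hk)
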